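/- arXiv:2410.07457 — 4 statements merged into one kernel-verified Lean document; each statement's English description precedes it below -/
import Mathlib

section
/- Let X be a nonempty subset of ℝ^n, ε ≥ 0, H ≥ 1 an integer, and f^1, …, f^H : X → ℝ. Let (Ω, 𝒫) be a probability space carrying a random vector σ with values in ℝ^m, and let ρ : ℝ^m × X → ℝ. Suppose x^1, …, x^{H+1} are X-valued measurable functions of σ such that for every value of σ: (i) ρ(σ, x^1(σ)) ≤ inf_{x∈X} ρ(σ, x) + ε, and (ii) for every t ∈ {2,…,H+1}, Σ_{τ=1}^{t−1} f^τ(x^t(σ)) + ρ(σ, x^t(σ)) ≤ inf_{x∈X} [Σ_{τ=1}^{t−1} f^τ(x) + ρ(σ, x)] + ε, where all the infima are assumed finite. Then for every x' ∈ X, assuming all the expectations below are finite, E[Σ_{t=1}^H f^t(x^t(σ))] − Σ_{t=1}^H f^t(x') ≤ Σ_{t=1}^H E[f^t(x^t(σ)) − f^t(x^{t+1}(σ))] + E[ρ(σ, x') − ρ(σ, x^1(σ))] + ε(H+1). -/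
open MeasureTheory

/-- **General regret bound for Follow-The-Perturbed-Leader with an ε-approximate oracle.**
`X ⊆ ℝ^n` nonempty, `ε ≥ 0`, `H ≥ 1`, costs `f 0, …, f (H-1)` (paper's `f^1, …, f^H`),
probability space `(Ω, P)`, random vector `σ : Ω → ℝ^m`, regularizer `ρ : ℝ^m × X → ℝ`.
`x 0` (paper's `x^1`) is an `ε`-approximate minimizer of `ρ(σ, ·)` over `X`, and for
`t = 1, …, H` the point `x t` (paper's `x^{t+1}`) is an `ε`-approximate minimizer of
`∑_{τ<t} f τ + ρ(σ, ·)` over `X`, for every value of `σ`; all infima are finite (`BddBelow`)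
and all expectations below are finite (`Integrable`).  Then for every `x' ∈ X`,
`E[∑_t f t (x t (σ))] − ∑_t f t x' ≤ ∑_t E[f t (x t σ) − f t (x (t+1) σ)]
  + E[ρ(σ, x') − ρ(σ, x 0 σ)] + ε (H+1)`. -/
theorem stmt1 {n m : ℕ} (X : Set (Fin n → ℝ)) (hX : X.Nonempty)
    (ε : ℝ) (hε : 0 ≤ ε) (H : ℕ) (hH : 1 ≤ H)
    (f : ℕ → (Fin n → ℝ) → ℝ)
    {Ω : Type*} [MeasurableSpace Ω] (P : Measure Ω) [IsProbabilityMeasure P]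
    (σ : Ω → (Fin m → ℝ)) (hσ : Measurable σ)
    (ρ : (Fin m → ℝ) → (Fin n → ℝ) → ℝ)
    (x : ℕ → (Fin m → ℝ) → (Fin n → ℝ)) (hxmeas : ∀ t, Measurable (x t))
    (hx0X : ∀ ω : Ω, x 0 (σ ω) ∈ X)
    (hBdd0 : ∀ ω : Ω, BddBelow ((fun y => ρ (σ ω) y) '' X))
    (hx0 : ∀ ω : Ω, ρ (σ ω) (x 0 (σ ω)) ≤ sInf ((fun y => ρ (σ ω) y) '' X) + ε)
    (hxtX : ∀ ω : Ω, ∀ t, 1 ≤ t → t ≤ H → x t (σ ω) ∈ X)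
    (hBddt : ∀ ω : Ω, ∀ t, 1 ≤ t → t ≤ H →
      BddBelow ((fun y => (∑ τ ∈ Finset.range t, f τ y) + ρ (σ ω) y) '' X))
    (hxt : ∀ ω : Ω, ∀ t, 1 ≤ t → t ≤ H →
      (∑ τ ∈ Finset.range t, f τ (x t (σ ω))) + ρ (σ ω) (x t (σ ω)) ≤
        sInf ((fun y => (∑ τ ∈ Finset.range t, f τ y) + ρ (σ ω) y) '' X) + ε)
    (x' : Fin n → ℝ) (hx' : x' ∈ X)
    (hInt1 : ∀ t < H, Integrable (fun ω => f t (x t (σ ω))) P)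
    (hInt2 : ∀ t < H, Integrable (fun ω => f t (x (t + 1) (σ ω))) P)
    (hInt3 : Integrable (fun ω => ρ (σ ω) x') P)
    (hInt4 : Integrable (fun ω => ρ (σ ω) (x 0 (σ ω))) P) :
    (∫ ω, (∑ t ∈ Finset.range H, f t (x t (σ ω))) ∂P) - ∑ t ∈ Finset.range H, f t x' ≤
      (∑ t ∈ Finset.range H, ∫ ω, (f t (x t (σ ω)) - f t (x (t + 1) (σ ω))) ∂P)
        + (∫ ω, (ρ (σ ω) x' - ρ (σ ω) (x 0 (σ ω))) ∂P) + ε * (H + 1) := by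
  have key : ∀ ω : Ω, ∀ t, t ≤ H → ∀ y ∈ X,
      ρ (σ ω) (x 0 (σ ω)) + ∑ τ ∈ Finset.range t, f τ (x (τ + 1) (σ ω)) ≤
        (∑ τ ∈ Finset.range t, f τ y) + ρ (σ ω) y + ε * (t + 1) := by
    intro ω t
    induction t with
    | zero =>
      intro _ y hy
      have h1 := csInf_le (hBdd0 ω) (Set.mem_image_of_mem _ hy)
      have h2 := hx0 ω
      simp only [Finset.range_zero, Finset.sum_empty, Nat.cast_zero] at *
      linarith
    | succ t ih =>
      intro ht y hy
      have h0 := ih (by omega) _ (hxtX ω (t + 1) (by omega) ht)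
      have h1 := csInf_le (hBddt ω (t + 1) (by omega) ht) (Set.mem_image_of_mem _ hy)
      have h2 := hxt ω (t + 1) (by omega) ht
      simp only [Finset.sum_range_succ] at *
      push_cast
      linarith
  have hI1 : Integrable (fun ω => ∑ t ∈ Finset.range H, f t (x t (σ ω))) P :=
    integrable_finsetSum _ (fun t ht => hInt1 t (Finset.mem_range.mp ht))
  have hI2 : Integrable (fun ω => ∑ t ∈ Finset.range H, f t (x (t + 1) (σ ω))) P :=
    integrable_finsetSum _ (fun t ht => hInt2 t (Finset.mem_range.mp ht))
  have e1 : (∑ t ∈ Finset.range H, ∫ ω, (f t (x t (σ ω)) - f t (x (t + 1) (σ ω))) ∂P) =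
      (∫ ω, (∑ t ∈ Finset.range H, f t (x t (σ ω))) ∂P) -
      ∫ ω, (∑ t ∈ Finset.range H, f t (x (t + 1) (σ ω))) ∂P := by
    rw [integral_finsetSum _ (fun t ht => hInt1 t (Finset.mem_range.mp ht)),
      integral_finsetSum _ (fun t ht => hInt2 t (Finset.mem_range.mp ht)),
      ← Finset.sum_sub_distrib]
    exact Finset.sum_congr rfl fun t ht => integral_sub
      (hInt1 t (Finset.mem_range.mp ht)) (hInt2 t (Finset.mem_range.mp ht))
  have h3 : ∫ ω, (∑ t ∈ Finset.range H, f t (x (t + 1) (σ ω))) ∂P ≤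
      ∫ ω, ((ρ (σ ω) x' - ρ (σ ω) (x 0 (σ ω))) +
        ((∑ t ∈ Finset.range H, f t x') + ε * (H + 1))) ∂P := by
    refine integral_mono hI2 ((hInt3.sub hInt4).add (integrable_const _)) fun ω => ?_
    have := key ω H le_rfl x' hx'
    dsimp only
    linarith
  have hI3 : Integrable (fun ω => ρ (σ ω) x' - ρ (σ ω) (x 0 (σ ω))) P := hInt3.sub hInt4
  rw [integral_add hI3 (integrable_const _)] at h3
  simp only [integral_const, probReal_univ, one_smul] at h3
  rw [e1]
  linarith
end

section
/- Let f : ℝ^n → ℝ be a bounded measurable function with |f(x)| ≤ B for all x ∈ ℝ^n, let ν > 0, and let σ = (σ_1,…,σ_n) be a random vector whose coordinates are i.i.d. uniform on the interval [0, 2/ν]. Then for any vectors G, c ∈ ℝ^n, |E[f(G + c + σ)] − E[f(G + σ)]| ≤ ν B ‖c‖₁, where ‖c‖₁ = Σ_{i=1}^n |c_i|. -/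
open MeasureTheory

/-- The law of a random vector in `ℝ^n` whose coordinates are i.i.d. uniform on `[0, 2/ν]`:
the product of `n` copies of the normalized Lebesgue measure on `[0, 2/ν]`. -/
noncomputable def uniformCube (n : ℕ) (ν : ℝ) : Measure (Fin n → ℝ) :=
  Measure.pi fun _ =>
    (ENNReal.ofReal (2 / ν))⁻¹ • (volume.restrict (Set.Icc (0 : ℝ) (2 / ν)))

noncomputable def unif1 (ν : ℝ) : Measure ℝ :=
  (ENNReal.ofReal (2 / ν))⁻¹ • (volume.restrict (Set.Icc (0 : ℝ) (2 / ν)))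

lemma unif1_prob (ν : ℝ) (hν : 0 < ν) : IsProbabilityMeasure (unif1 ν) := by
  constructor
  have h : 0 < 2 / ν := by positivity
  simp only [unif1, Measure.smul_apply, smul_eq_mul, Measure.restrict_apply_univ, Real.volume_Icc,
    sub_zero]
  exact ENNReal.inv_mul_cancel (by simpa using h) ENNReal.ofReal_ne_top

lemma unif1_integral (ν : ℝ) (hν : 0 < ν) (g : ℝ → ℝ) :
    ∫ x, g x ∂(unif1 ν) = (ν / 2) * ∫ x in (0:ℝ)..(2/ν), g x := by
  have h : 0 < 2 / ν := by positivity
  rw [unif1, integral_smul_measure, intervalIntegral.integral_of_le h.le,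
    integral_Icc_eq_integral_Ioc, ENNReal.toReal_inv, ENNReal.toReal_ofReal h.le, smul_eq_mul,
    inv_div]

lemma unif1_shift (ν : ℝ) (hν : 0 < ν) (g : ℝ → ℝ) (hg : Measurable g) (B : ℝ)
    (hB : ∀ x, |g x| ≤ B) (c : ℝ) :
    |(∫ x, g (c + x) ∂(unif1 ν)) - ∫ x, g x ∂(unif1 ν)| ≤ ν * B * |c| := by
  have hi : ∀ a b : ℝ, IntervalIntegrable g volume a b := by
    intro a b
    refine (intervalIntegrable_const (c := B)).mono_fun hg.aestronglyMeasurable ?_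
    refine Filter.Eventually.of_forall fun x => ?_
    exact (hB x).trans (le_abs_self B)
  rw [unif1_integral ν hν, unif1_integral ν hν, intervalIntegral.integral_comp_add_left, ← mul_sub,
    intervalIntegral.integral_interval_sub_interval_comm (hi _ _) (hi _ _) (hi _ _)]
  have h1 := intervalIntegral.norm_integral_le_of_norm_le_const (a := c + 0) (b := 0) (C := B)
    (f := g) (fun x _ => hB x)
  have h2 := intervalIntegral.norm_integral_le_of_norm_le_const (a := c + 2/ν) (b := 2/ν) (C := B)
    (f := g) (fun x _ => hB x)
  have e1 : |0 - (c + 0)| = |c| := by rw [← abs_neg]; congr 1; ring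
  have e2 : |2/ν - (c + 2/ν)| = |c| := by rw [← abs_neg]; congr 1; ring
  rw [e1] at h1
  rw [e2] at h2
  rw [abs_mul, abs_of_pos (by positivity : 0 < ν / 2)]
  have h3 := (abs_sub (∫ x in c + 0..0, g x) (∫ x in c + 2/ν..2/ν, g x)).trans (add_le_add h1 h2)
  calc _ ≤ ν / 2 * (B * |c| + B * |c|) := by gcongr
    _ = _ := by ring

lemma uniformCube_prob (n : ℕ) (ν : ℝ) (hν : 0 < ν) : IsProbabilityMeasure (uniformCube n ν) := by
  have := unif1_prob ν hν
  change IsProbabilityMeasure (Measure.pi fun _ : Fin n => unif1 ν)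
  infer_instance

lemma int_bdd {α : Type*} [MeasurableSpace α] (μ : Measure α) [IsProbabilityMeasure μ]
    (f : α → ℝ) (hf : Measurable f) (B : ℝ) (hB : ∀ x, |f x| ≤ B) : Integrable f μ :=
  Integrable.of_bound hf.aestronglyMeasurable B (Filter.Eventually.of_forall hB)

lemma abs_int_le {α : Type*} [MeasurableSpace α] (μ : Measure α) [IsProbabilityMeasure μ]
    (f : α → ℝ) (B : ℝ) (hB : ∀ x, |f x| ≤ B) : |∫ x, f x ∂μ| ≤ B := by
  simpa using norm_integral_le_of_norm_le_const (μ := μ) (f := f) (Filter.Eventually.of_forall hB)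

lemma meas_cons (n : ℕ) : Measurable fun p : (Fin n → ℝ) × ℝ => (Fin.cons p.2 p.1 : Fin (n+1) → ℝ) := by
  refine measurable_pi_lambda _ fun i => ?_
  refine Fin.cases ?_ (fun j => ?_) i
  · simpa using measurable_snd
  · simp only [Fin.cons_succ]
    exact (measurable_pi_apply j).comp measurable_fst

lemma cube_succ (n : ℕ) (ν : ℝ) (hν : 0 < ν) (f : (Fin (n+1) → ℝ) → ℝ) (hf : Measurable f)
    (B : ℝ) (hB : ∀ x, |f x| ≤ B) :
    ∫ x, f x ∂(uniformCube (n+1) ν) =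
      ∫ s, ∫ a, f (Fin.cons a s) ∂(unif1 ν) ∂(uniformCube n ν) := by
  have := unif1_prob ν hν
  have := uniformCube_prob n ν hν
  have hm := (measurePreserving_piFinSuccAbove (fun _ : Fin (n+1) => unif1 ν) 0).symm
  have h1 := hm.integral_comp' f
  change _ = ∫ x, f x ∂(uniformCube (n+1) ν) at h1
  rw [← h1]
  change ∫ p : ℝ × (Fin n → ℝ), f (Fin.insertNth 0 p.1 p.2) ∂((unif1 ν).prod (uniformCube n ν)) = _
  simp only [Fin.insertNth_zero']
  rw [← integral_prod_swap, integral_prod]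
  · rfl
  · exact int_bdd _ _ (hf.comp (meas_cons n)) B (fun x => hB _)

lemma cube_shift (ν : ℝ) (hν : 0 < ν) (B : ℝ) : ∀ (n : ℕ) (f : (Fin n → ℝ) → ℝ) (_ : Measurable f)
    (_ : ∀ x, |f x| ≤ B) (c : Fin n → ℝ),
    |(∫ σ, f (c + σ) ∂(uniformCube n ν)) - ∫ σ, f σ ∂(uniformCube n ν)| ≤
      ν * B * ∑ i, |c i| := by
  intro n
  induction n with
  | zero =>
    intro f hf hB c
    have : ∀ σ, c + σ = σ := fun σ => Subsingleton.elim _ _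
    simp [this]
  | succ n ih =>
    intro f hf hB c
    have := unif1_prob ν hν
    have := uniformCube_prob n ν hν
    rw [cube_succ n ν hν f hf B hB,
      cube_succ n ν hν (fun σ => f (c + σ)) (hf.comp (measurable_const_add c)) B (fun x => hB _)]
    have hc : ∀ a s, c + (Fin.cons a s : Fin (n+1) → ℝ) = Fin.cons (c 0 + a) (Fin.tail c + s) := by
      intro a s
      funext i
      refine Fin.cases ?_ (fun j => ?_) i <;> simp [Fin.tail]
    simp only [hc]
    set H : ℝ → (Fin n → ℝ) → ℝ := fun t s => ∫ a, f (Fin.cons (t + a) s) ∂(unif1 ν) with hH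
    have hHm : ∀ t, Measurable (H t) := by
      intro t
      have h : Measurable fun p : (Fin n → ℝ) × ℝ => f (Fin.cons (t + p.2) p.1) :=
        hf.comp ((meas_cons n).comp (measurable_fst.prodMk (measurable_snd.const_add t)))
      exact h.stronglyMeasurable.integral_prod_right.measurable
    have hHB : ∀ t s, |H t s| ≤ B := fun t s => abs_int_le _ _ _ fun _ => hB _
    have h0 : ∀ s, ∫ a, f (Fin.cons a s) ∂(unif1 ν) = H 0 s := by intro s; simp [hH]
    simp only [h0]
    have i1 := ih (H (c 0)) (hHm _) (hHB _) (Fin.tail c)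
    have i2 : |(∫ s, H (c 0) s ∂(uniformCube n ν)) - ∫ s, H 0 s ∂(uniformCube n ν)|
        ≤ ν * B * |c 0| := by
      rw [← integral_sub (int_bdd _ _ (hHm _) B (hHB _)) (int_bdd _ _ (hHm _) B (hHB _))]
      refine abs_int_le _ _ _ fun s => ?_
      rw [← h0]
      exact unif1_shift ν hν (fun a => f (Fin.cons a s))
        (hf.comp ((meas_cons n).comp (measurable_const.prodMk measurable_id))) B (fun _ => hB _) (c 0)
    rw [Fin.sum_univ_succ, mul_add]
    refine (abs_sub_le _ (∫ s, H (c 0) s ∂(uniformCube n ν)) _).trans ?_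
    rw [add_comm]
    exact add_le_add i2 i1

/-- **(Kalai–Vempala) Shift-stability of expectations under uniform perturbations.**
If `f : ℝ^n → ℝ` is bounded measurable with `|f| ≤ B`, `ν > 0`, and `σ` is uniform on the
cube `[0, 2/ν]^n`, then for any `G, c ∈ ℝ^n`,
`|E[f(G + c + σ)] − E[f(G + σ)]| ≤ ν B ‖c‖₁`. -/
theorem stmt2 {n : ℕ} (f : (Fin n → ℝ) → ℝ) (hf : Measurable f)
    (B : ℝ) (hB : ∀ x, |f x| ≤ B) (ν : ℝ) (hν : 0 < ν) (G c : Fin n → ℝ) :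
    |(∫ σ, f (G + c + σ) ∂(uniformCube n ν)) - ∫ σ, f (G + σ) ∂(uniformCube n ν)| ≤
      ν * B * ∑ i, |c i| := by
  have h := cube_shift ν hν B n (fun x => f (G + x)) (hf.comp (measurable_const_add G))
    (fun x => hB _) c
  simpa only [add_assoc] using h
end

section
/- Let η > 0 and let V^1, …, V^K ∈ ℝ^{N×M} be matrices, and set L = 2η max_{k∈[K]} ‖V^k‖₁. Then for every k ∈ {1,…,K} and all x, z in the standard simplex Δ_N, the quantal response maps satisfy ‖y_{V^k}(x) − y_{V^k}(z)‖₁ ≤ L ‖x − z‖_∞. -/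
/-- The quantal response map: `(qr η V x) i = exp(η⟨V_i, x⟩) / ∑_j exp(η⟨V_j, x⟩)`,
where `V_i` is the `i`-th column of `V ∈ ℝ^{N×M}`. -/
noncomputable def qr {N M : ℕ} (η : ℝ) (V : Matrix (Fin N) (Fin M) ℝ)
    (x : Fin N → ℝ) (i : Fin M) : ℝ :=
  Real.exp (η * ∑ n, V n i * x n) / ∑ j, Real.exp (η * ∑ n, V n j * x n)

/-- The induced operator `1`-norm of a matrix `A`: `sup_{‖u‖₁ = 1} ‖A u‖₁`. -/
noncomputable def l1OpNorm {N M : ℕ} (A : Matrix (Fin N) (Fin M) ℝ) : ℝ :=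
  sSup {r : ℝ | ∃ u : Fin M → ℝ, (∑ j, |u j|) = 1 ∧ r = ∑ i, |A.mulVec u i|}

theorem aux_g (d : ℝ) (hd : 0 ≤ d) : 0 ≤ (d - 2) * Real.exp d + d + 2 := by
  have hder : ∀ x : ℝ, HasDerivAt (fun d : ℝ => (d - 2) * Real.exp d + d + 2)
      ((x - 1) * Real.exp x + 1) x := by
    intro x
    have h := ((((hasDerivAt_id x).sub_const 2).mul (Real.hasDerivAt_exp x)).add
      (hasDerivAt_id x)).add_const 2
    refine h.congr_deriv ?_
    simp only [id]
    ring
  have hm : Monotone (fun d : ℝ => (d - 2) * Real.exp d + d + 2) := by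
    apply monotone_of_deriv_nonneg
    · exact fun x => (hder x).differentiableAt
    · intro x
      rw [(hder x).deriv]
      have h1 := Real.add_one_le_exp (-x)
      have h2 : Real.exp (-x) * Real.exp x = 1 := by rw [← Real.exp_add]; simp
      nlinarith [Real.exp_pos x]
  have := hm hd
  simp at this
  linarith

theorem aux_exp_le (s t : ℝ) (h : t ≤ s) :
    |Real.exp s - Real.exp t| ≤ |s - t| / 2 * (Real.exp s + Real.exp t) := by
  have h1 := aux_g (s - t) (by linarith)
  have h2 : Real.exp s = Real.exp (s - t) * Real.exp t := by rw [← Real.exp_add]; simp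
  rw [abs_of_nonneg (by linarith [Real.exp_le_exp.mpr h]), abs_of_nonneg (by linarith), h2]
  nlinarith [mul_nonneg h1 (Real.exp_pos t).le]

theorem aux_exp (s t : ℝ) :
    |Real.exp s - Real.exp t| ≤ |s - t| / 2 * (Real.exp s + Real.exp t) := by
  rcases le_total t s with h | h
  · exact aux_exp_le s t h
  · rw [abs_sub_comm, abs_sub_comm s t, add_comm]
    exact aux_exp_le t s h

theorem aux_softmax {M : ℕ} (a b : Fin M → ℝ) (δ : ℝ) (hδ : 0 ≤ δ)
    (h : ∀ i, |a i - b i| ≤ δ) :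
    (∑ i, |Real.exp (a i) / ∑ j, Real.exp (a j) - Real.exp (b i) / ∑ j, Real.exp (b j)|)
      ≤ 2 * δ := by
  rcases isEmpty_or_nonempty (Fin M) with hM | hM
  · simp [hδ]
  set A := ∑ j, Real.exp (a j) with hA
  set B := ∑ j, Real.exp (b j) with hB
  have hAp : 0 < A := Finset.sum_pos (fun i _ => Real.exp_pos _) Finset.univ_nonempty
  have hBp : 0 < B := Finset.sum_pos (fun i _ => Real.exp_pos _) Finset.univ_nonempty
  have key : ∀ i, |Real.exp (a i) / A - Real.exp (b i) / B|
      ≤ δ * (Real.exp (a i) * B + Real.exp (b i) * A) / (A * B) := by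
    intro i
    have e1 : Real.exp (a i) / A - Real.exp (b i) / B
        = (Real.exp (a i) * B - Real.exp (b i) * A) / (A * B) := by
      field_simp
    rw [e1, abs_div, abs_of_pos (mul_pos hAp hBp)]
    apply div_le_div_of_nonneg_right _ (mul_pos hAp hBp).le
    rw [hA, hB, Finset.mul_sum, Finset.mul_sum, ← Finset.sum_sub_distrib,
      ← Finset.sum_add_distrib, Finset.mul_sum]
    refine (Finset.abs_sum_le_sum_abs _ _).trans (Finset.sum_le_sum fun j _ => ?_)
    rw [← Real.exp_add, ← Real.exp_add]
    refine (aux_exp _ _).trans ?_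
    apply mul_le_mul_of_nonneg_right _ (by positivity)
    have h1 := abs_le.mp (h i)
    have h2 := abs_le.mp (h j)
    have : |a i + b j - (b i + a j)| ≤ 2 * δ := by
      rw [abs_le]; constructor <;> linarith
    linarith
  refine (Finset.sum_le_sum fun i _ => key i).trans ?_
  rw [← Finset.sum_div, ← Finset.mul_sum, Finset.sum_add_distrib, ← Finset.sum_mul,
    ← Finset.sum_mul, ← hA, ← hB]
  apply le_of_eq
  field_simp
  ring

theorem aux_nonneg {N M : ℕ} (A : Matrix (Fin N) (Fin M) ℝ) : 0 ≤ l1OpNorm A := by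
  apply Real.sSup_nonneg
  rintro r ⟨u, _, rfl⟩
  positivity

theorem aux_col {N M : ℕ} (A : Matrix (Fin N) (Fin M) ℝ) (j : Fin M) :
    ∑ n, |A n j| ≤ l1OpNorm A := by
  apply le_csSup
  · refine ⟨∑ i, ∑ j, |A i j|, ?_⟩
    rintro r ⟨u, hu, rfl⟩
    apply Finset.sum_le_sum
    intro i _
    change |∑ j, A i j * u j| ≤ ∑ j, |A i j|
    refine (Finset.abs_sum_le_sum_abs _ _).trans (Finset.sum_le_sum fun j _ => ?_)
    rw [abs_mul]
    have : |u j| ≤ 1 := by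
      rw [← hu]
      exact Finset.single_le_sum (f := fun j => |u j|) (fun i _ => abs_nonneg _)
        (Finset.mem_univ j)
    exact mul_le_of_le_one_right (abs_nonneg _) this
  · refine ⟨Pi.single j 1, ?_, ?_⟩
    · rw [Finset.sum_eq_single j]
      · simp
      · intro b _ hb
        simp [hb]
      · simp
    · simp

/-- **Lipschitz quantal response (Claim 1).** For `η > 0`, matrices `V^1, …, V^K` and
`L = 2η max_k ‖V^k‖₁`, every quantal response map satisfies
`‖y_{V^k}(x) − y_{V^k}(z)‖₁ ≤ L ‖x − z‖_∞` for `x, z` in the simplex `Δ_N`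
(the norm `‖x - z‖` on `Fin N → ℝ` is the sup norm). -/
theorem stmt4 {N M K : ℕ} (hK : 0 < K) (η : ℝ) (hη : 0 < η)
    (V : Fin K → Matrix (Fin N) (Fin M) ℝ) (L : ℝ)
    (hL : L = 2 * η * Finset.univ.sup' (Finset.univ_nonempty_iff.mpr ⟨⟨0, hK⟩⟩)
      (fun k => l1OpNorm (V k))) :
    ∀ k : Fin K, ∀ x ∈ stdSimplex ℝ (Fin N), ∀ z ∈ stdSimplex ℝ (Fin N),
      (∑ i, |qr η (V k) x i - qr η (V k) z i|) ≤ L * ‖x - z‖ := by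
  intro k x _ z _
  have hsup : l1OpNorm (V k) ≤ Finset.univ.sup' (Finset.univ_nonempty_iff.mpr ⟨⟨0, hK⟩⟩)
      (fun k => l1OpNorm (V k)) :=
    Finset.le_sup' (fun k => l1OpNorm (V k)) (Finset.mem_univ k)
  have h0 := aux_nonneg (V k)
  have hs := aux_softmax (fun i => η * ∑ n, V k n i * x n) (fun i => η * ∑ n, V k n i * z n)
    (η * (l1OpNorm (V k) * ‖x - z‖)) (by positivity) (by
      intro i
      rw [← mul_sub, abs_mul, abs_of_pos hη, ← Finset.sum_sub_distrib]
      apply mul_le_mul_of_nonneg_left _ hη.le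
      refine (Finset.abs_sum_le_sum_abs _ _).trans ?_
      refine le_trans ?_ (mul_le_mul_of_nonneg_right (aux_col (V k) i) (norm_nonneg _))
      rw [Finset.sum_mul]
      refine Finset.sum_le_sum fun n _ => ?_
      rw [← mul_sub, abs_mul]
      exact mul_le_mul_of_nonneg_left (norm_le_pi_norm (x - z) n) (abs_nonneg _))
  refine hs.trans ?_
  rw [hL]
  have := mul_le_mul_of_nonneg_left (mul_le_mul_of_nonneg_right hsup (norm_nonneg (x - z)))
    (by positivity : 0 ≤ 2 * η)
  linarith
end

section
/- Let η > 0, let V^1, …, V^K ∈ ℝ^{N×M}, set L = 2η max_{k∈[K]} ‖V^k‖₁, let U ∈ ℝ^{N×M}, and let g ∈ ℝ^K be a vector with nonnegative entries. Then for all x, z in the standard simplex Δ_N, |xᵀ U (𝒴_QR(x) − 𝒴_QR(z)) g| ≤ L ‖U‖₁ ‖g‖₁ ‖x − z‖_∞. -/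
lemma col_le {N M : ℕ} (A : Matrix (Fin N) (Fin M) ℝ) (j : Fin M) :
    ∑ i, |A i j| ≤ l1OpNorm A := by
  unfold l1OpNorm
  apply le_csSup
  · refine ⟨∑ i, ∑ j, |A i j|, ?_⟩
    rintro r ⟨u, hu, rfl⟩
    apply Finset.sum_le_sum
    intro i _
    simp only [Matrix.mulVec, dotProduct]
    refine (Finset.abs_sum_le_sum_abs _ _).trans (Finset.sum_le_sum ?_)
    intro k _
    rw [abs_mul]
    have : |u k| ≤ 1 := by
      rw [← hu]
      exact Finset.single_le_sum (f := fun j => |u j|) (fun _ _ => abs_nonneg _)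
        (Finset.mem_univ k)
    exact mul_le_of_le_one_right (abs_nonneg _) this
  · refine ⟨Pi.single j 1, ?_, ?_⟩
    · rw [Finset.sum_eq_single j]
      · simp
      · intro b _ hb
        simp [hb]
      · simp
    · simp

lemma log_ineq {p q : ℝ} (hp : 0 < p) (hq : 0 < q) :
    (p - q) ^ 2 / (p + q) ≤ (p - q) * (Real.log p - Real.log q) := by
  wlog h : q ≤ p generalizing p q
  · have := this hq hp (le_of_not_ge h)
    rw [add_comm]
    calc _ = (q - p) ^ 2 / (q + p) := by ring
      _ ≤ _ := this
      _ = _ := by ring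
  have h1 := Real.log_le_sub_one_of_pos (div_pos hq hp)
  rw [Real.log_div hq.ne' hp.ne'] at h1
  have h2 : (p - q) / p = 1 - q / p := by field_simp
  have h3 : (p - q) / (p + q) ≤ (p - q) / p :=
    div_le_div_of_nonneg_left (by linarith) hp (by linarith)
  have h4 : (p - q) ^ 2 / (p + q) = (p - q) * ((p - q) / (p + q)) := by ring
  rw [h4]
  exact mul_le_mul_of_nonneg_left (by linarith) (by linarith)

lemma qr_l1 {N M : ℕ} (η : ℝ) (hη : 0 < η) (V : Matrix (Fin N) (Fin M) ℝ)
    (x z : Fin N → ℝ) :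
    ∑ j, |qr η V x j - qr η V z j| ≤ 2 * η * l1OpNorm V * ‖x - z‖ := by
  rcases Nat.eq_zero_or_pos M with rfl | hM
  · simp [l1OpNorm]
  haveI : Nonempty (Fin M) := ⟨⟨0, hM⟩⟩
  have hZ : ∀ y : Fin N → ℝ, 0 < ∑ j, Real.exp (η * ∑ n, V n j * y n) := fun y =>
    Finset.sum_pos (fun _ _ => Real.exp_pos _) Finset.univ_nonempty
  have hpos : ∀ y j, 0 < qr η V y j := fun y j => div_pos (Real.exp_pos _) (hZ y)
  have hsum : ∀ y, ∑ j, qr η V y j = 1 := by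
    intro y
    unfold qr
    rw [← Finset.sum_div, div_self (hZ y).ne']
  have hlog : ∀ y j, Real.log (qr η V y j) = η * ∑ n, V n j * y n -
      Real.log (∑ j, Real.exp (η * ∑ n, V n j * y n)) := by
    intro y j
    unfold qr
    rw [Real.log_div (Real.exp_pos _).ne' (hZ y).ne', Real.log_exp]
  set p := qr η V x with hp
  set q := qr η V z with hq
  set D := ∑ j, |p j - q j| with hD
  have hD0 : 0 ≤ D := Finset.sum_nonneg fun _ _ => abs_nonneg _
  set t := η * l1OpNorm V * ‖x - z‖ with ht
  have hd : ∀ j, |η * ∑ n, V n j * x n - η * ∑ n, V n j * z n| ≤ t := by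
    intro j
    rw [← mul_sub, ← Finset.sum_sub_distrib, abs_mul, abs_of_pos hη, ht, mul_assoc]
    refine mul_le_mul_of_nonneg_left ?_ hη.le
    refine (Finset.abs_sum_le_sum_abs _ _).trans ?_
    refine le_trans ?_ (mul_le_mul_of_nonneg_right (col_le V j) (norm_nonneg _))
    rw [Finset.sum_mul]
    refine Finset.sum_le_sum fun n _ => ?_
    rw [← mul_sub, abs_mul]
    exact mul_le_mul_of_nonneg_left (norm_le_pi_norm (x - z) n) (abs_nonneg _)
  have h1 : ∑ j, (p j - q j) * (Real.log (p j) - Real.log (q j)) ≤ t * D := by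
    have e : ∑ j, (p j - q j) * (Real.log (p j) - Real.log (q j)) =
        ∑ j, (p j - q j) * (η * ∑ n, V n j * x n - η * ∑ n, V n j * z n) := by
      have e0 : ∑ j, (p j - q j) = 0 := by
        rw [Finset.sum_sub_distrib, hsum, hsum, sub_self]
      rw [← sub_eq_zero, ← Finset.sum_sub_distrib]
      rw [← zero_mul (Real.log (∑ j, Real.exp (η * ∑ n, V n j * z n)) -
        Real.log (∑ j, Real.exp (η * ∑ n, V n j * x n))), ← e0, Finset.sum_mul]
      refine Finset.sum_congr rfl fun j _ => ?_
      rw [hlog, hlog]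
      ring
    rw [e, hD, Finset.mul_sum]
    refine Finset.sum_le_sum fun j _ => ?_
    refine (le_abs_self _).trans ?_
    rw [abs_mul, mul_comm]
    exact mul_le_mul_of_nonneg_right (hd j) (abs_nonneg _)
  have h2 : D ^ 2 / 2 ≤ ∑ j, (p j - q j) ^ 2 / (p j + q j) := by
    have := Finset.sq_sum_div_le_sum_sq_div Finset.univ (fun j => |p j - q j|)
      (g := fun j => p j + q j) (fun j _ => add_pos (hpos x j) (hpos z j))
    simp only [sq_abs] at this
    rw [Finset.sum_add_distrib, hsum, hsum] at this
    norm_num at this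
    exact this
  have h3 : ∑ j, (p j - q j) ^ 2 / (p j + q j) ≤
      ∑ j, (p j - q j) * (Real.log (p j) - Real.log (q j)) :=
    Finset.sum_le_sum fun j _ => log_ineq (hpos x j) (hpos z j)
  have h4 : D * D ≤ (2 * t) * D := by nlinarith
  have h5 : 2 * η * l1OpNorm V * ‖x - z‖ = 2 * t := by rw [ht]; ring
  rw [h5]
  rcases hD0.eq_or_lt with h | h
  · rw [← h]
    have := (abs_nonneg _).trans (hd ⟨0, hM⟩)
    linarith
  · exact le_of_mul_le_mul_right h4 h

/-- **Lipschitz continuity of the leader utility (Corollary 1, second bound).**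
For `η > 0`, matrices `V^1, …, V^K`, `L = 2η max_k ‖V^k‖₁`, a matrix `U ∈ ℝ^{N×M}` and a
nonnegative vector `g ∈ ℝ^K`, for all `x, z ∈ Δ_N`:
`|xᵀ U (𝒴_QR(x) − 𝒴_QR(z)) g| ≤ L ‖U‖₁ ‖g‖₁ ‖x − z‖_∞`,
where `xᵀ U 𝒴_QR(x) g = ∑_k g_k ∑_i x_i ∑_j U_{ij} (y_{V^k}(x))_j` and `‖x - z‖` on
`Fin N → ℝ` is the sup norm. -/
theorem stmt6 {N M K : ℕ} (hK : 0 < K) (η : ℝ) (hη : 0 < η)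
    (V : Fin K → Matrix (Fin N) (Fin M) ℝ) (L : ℝ)
    (hL : L = 2 * η * Finset.univ.sup' (Finset.univ_nonempty_iff.mpr ⟨⟨0, hK⟩⟩)
      (fun k => l1OpNorm (V k)))
    (U : Matrix (Fin N) (Fin M) ℝ) (g : Fin K → ℝ) (hg : ∀ k, 0 ≤ g k) :
    ∀ x ∈ stdSimplex ℝ (Fin N), ∀ z ∈ stdSimplex ℝ (Fin N),
      |∑ k, g k * ∑ i, x i * ∑ j, U i j * (qr η (V k) x j - qr η (V k) z j)| ≤
      L * l1OpNorm U * (∑ k, |g k|) * ‖x - z‖ := by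
  intro x hx z hz
  have hU : ∀ k, |∑ i, x i * ∑ j, U i j * (qr η (V k) x j - qr η (V k) z j)| ≤
      L * l1OpNorm U * ‖x - z‖ := by
    intro k
    rcases Nat.eq_zero_or_pos M with rfl | hM
    · simp [l1OpNorm]
    have hU0 : 0 ≤ l1OpNorm U :=
      (Finset.sum_nonneg fun _ _ => abs_nonneg _).trans (col_le U ⟨0, hM⟩)
    have hx1 : ∀ i, |x i| ≤ 1 := by
      intro i
      rw [abs_of_nonneg (hx.1 i), ← hx.2]
      exact Finset.single_le_sum (fun j _ => hx.1 j) (Finset.mem_univ i)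
    have hLk : 2 * η * l1OpNorm (V k) ≤ L := by
      rw [hL]
      refine mul_le_mul_of_nonneg_left ?_ (by positivity)
      exact Finset.le_sup' (fun k => l1OpNorm (V k)) (Finset.mem_univ k)
    have e : ∑ i, x i * ∑ j, U i j * (qr η (V k) x j - qr η (V k) z j) =
        ∑ j, (∑ i, x i * U i j) * (qr η (V k) x j - qr η (V k) z j) := by
      simp only [Finset.mul_sum, Finset.sum_mul]
      rw [Finset.sum_comm]
      simp only [mul_assoc]
    rw [e]
    calc _ ≤ ∑ j, l1OpNorm U * |qr η (V k) x j - qr η (V k) z j| := by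
          refine (Finset.abs_sum_le_sum_abs _ _).trans (Finset.sum_le_sum fun j _ => ?_)
          rw [abs_mul]
          refine mul_le_mul_of_nonneg_right ?_ (abs_nonneg _)
          refine (Finset.abs_sum_le_sum_abs _ _).trans (le_trans ?_ (col_le U j))
          refine Finset.sum_le_sum fun i _ => ?_
          rw [abs_mul]
          exact mul_le_of_le_one_left (abs_nonneg _) (hx1 i)
      _ = l1OpNorm U * ∑ j, |qr η (V k) x j - qr η (V k) z j| := by rw [Finset.mul_sum]
      _ ≤ l1OpNorm U * (L * ‖x - z‖) :=
          mul_le_mul_of_nonneg_left ((qr_l1 η hη (V k) x z).trans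
            (mul_le_mul_of_nonneg_right hLk (norm_nonneg _))) hU0
      _ = _ := by ring
  refine (Finset.abs_sum_le_sum_abs _ _).trans ?_
  calc _ ≤ ∑ k, |g k| * (L * l1OpNorm U * ‖x - z‖) := by
        refine Finset.sum_le_sum fun k _ => ?_
        rw [abs_mul]
        exact mul_le_mul_of_nonneg_left (hU k) (abs_nonneg _)
    _ = _ := by rw [← Finset.sum_mul]; ring
end
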